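/- Let L be a finite geometric lattice, R a ring with 1, D = (U_0, (U_a)_{a ∈ A(L)}) an atomic datum over R with respect to L, and V = O(D, L) its minimal complex. Then V is supported on indecomposables (i.e. V_x = 0 for every decomposable x ∈ L) if and only if D is orthogonal (i.e. U_a ∩ U_b = 0 for all distinct atoms a, b with a ⊔ b decomposable). -/

import Mathlib

/-- A finite lattice is atomistic: every element is a join (finite sup) of atoms. -/
def Atomistic (L : Type*) [Lattice L] [OrderBot L] : Prop :=
  ∀ x : L, ∃ s : Finset L, (∀ a ∈ s, IsAtom a) ∧ s.sup id = x

/-- Semimodularity: whenever `a ⊓ b` is covered by `a`, `b` is covered by `a ⊔ b`. -/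
def Semimodular (L : Type*) [Lattice L] : Prop :=
  ∀ a b : L, a ⊓ b ⋖ a → b ⋖ a ⊔ b

/-- `rk` is the rank function: it vanishes at `⊥` and increases by one along covers. -/
def IsRankFunction {L : Type*} [Lattice L] [OrderBot L] (rk : L → ℕ) : Prop :=
  rk ⊥ = 0 ∧ ∀ x y : L, x ⋖ y → rk y = rk x + 1

/-- An element `x ≠ ⊥` is decomposable if `x = y ⊔ z` with `y, z ≠ ⊥` such that every atom
below `x` lies below exactly one of `y` and `z`. -/
def Decomposable {L : Type*} [Lattice L] [OrderBot L] (x : L) : Prop :=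
  ∃ y z : L, y ≠ ⊥ ∧ z ≠ ⊥ ∧ y ⊔ z = x ∧
    ∀ a : L, IsAtom a → a ≤ x → Xor' (a ≤ y) (a ≤ z)

/-- An element is indecomposable if it is `≠ ⊥` and not decomposable. -/
def Indecomposable {L : Type*} [Lattice L] [OrderBot L] (x : L) : Prop :=
  x ≠ ⊥ ∧ ¬ Decomposable x

section ComplexDefs

variable {R : Type*} [Ring R] {L : Type*} [Lattice L] [BoundedOrder L]

/-- A compatible `L`-grading on a chain complex `(V, d)` of `R`-modules:
`d` squares to zero, the graded piece `V_x` lives in degree `rk x` (we record a piece in every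
degree, which is `⊥` off the rank), each degree is the internal direct sum of its pieces, and
the differential maps `V_x` into `⊕_{y ⋖ x} V_y`. -/
def IsCompatGrading [DecidableEq L] (rk : L → ℕ) (V : ℕ → Type*)
    [∀ i, AddCommGroup (V i)] [∀ i, Module R (V i)]
    (d : ∀ i, V (i + 1) →ₗ[R] V i) (Vx : L → ∀ i, Submodule R (V i)) : Prop :=
  (∀ (i : ℕ) (v : V (i + 2)), d i (d (i + 1) v) = 0) ∧
  (∀ (x : L) (i : ℕ), i ≠ rk x → Vx x i = ⊥) ∧
  (∀ i : ℕ, DirectSum.IsInternal (fun x : L => Vx x i)) ∧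
  (∀ (i : ℕ) (x : L), rk x = i + 1 →
    Submodule.map (d i) (Vx x (i + 1)) ≤ ⨆ y ∈ {y : L | y ⋖ x}, Vx y i)

/-- The degree-`i` part of the subcomplex `V_{≤ x}`. -/
def Vle {V : ℕ → Type*} [∀ i, AddCommGroup (V i)] [∀ i, Module R (V i)]
    (Vx : L → ∀ i, Submodule R (V i)) (x : L) (i : ℕ) : Submodule R (V i) :=
  ⨆ y ∈ {y : L | y ≤ x}, Vx y i

/-- Acyclicity of the subcomplex `V_{≤x}`: `Ker ∂_j = Im ∂_{j+1}` at all positions `j ≥ 1`. -/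
def AcyclicOn {V : ℕ → Type*} [∀ i, AddCommGroup (V i)] [∀ i, Module R (V i)]
    (d : ∀ i, V (i + 1) →ₗ[R] V i) (Vx : L → ∀ i, Submodule R (V i)) (x : L) : Prop :=
  ∀ i : ℕ, Vle Vx x (i + 1) ⊓ LinearMap.ker (d i) =
    Submodule.map (d (i + 1)) (Vle Vx x (i + 2))

/-- Acyclicity of the complex: `Ker ∂_j = Im ∂_{j+1}` at all positions `j ≥ 1`. -/
def Acyclic {V : ℕ → Type*} [∀ i, AddCommGroup (V i)] [∀ i, Module R (V i)]
    (d : ∀ i, V (i + 1) →ₗ[R] V i) : Prop :=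
  ∀ i : ℕ, LinearMap.ker (d i) = LinearMap.range (d (i + 1))

/-- `(V, d, Vx)` is the minimal complex of its atomic datum `(V_⊥, (∂(V_a))_a)`:
the bottom piece is everything in degree `0`, the differential is injective on each atom piece,
and for `rk x ≥ 2` the differential is injective on `V_x` with image exactly the kernel of
`∂` on `V_{≺x} = ⊕_{y ⋖ x} V_y`. -/
def IsMinimal (rk : L → ℕ) {V : ℕ → Type*} [∀ i, AddCommGroup (V i)] [∀ i, Module R (V i)]
    (d : ∀ i, V (i + 1) →ₗ[R] V i) (Vx : L → ∀ i, Submodule R (V i)) : Prop :=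
  Vx ⊥ 0 = ⊤ ∧
  (∀ a : L, IsAtom a → ∀ v ∈ Vx a 1, d 0 v = 0 → v = 0) ∧
  (∀ (i : ℕ) (x : L), rk x = i + 2 →
    (∀ v ∈ Vx x (i + 2), d (i + 1) v = 0 → v = 0) ∧
    Submodule.map (d (i + 1)) (Vx x (i + 2)) =
      (⨆ y ∈ {y : L | y ⋖ x}, Vx y (i + 1)) ⊓ LinearMap.ker (d i))

/-- The subcomplex `V_{≤x}` admits an `L_{≤x}`-homotopy: a contracting homotopy
(`h0` on the image of `∂_1`, `h j` in positions `j ≥ 1`) which moves each graded piece `V_z`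
(`⊥ ≠ z ≤ x`) into `⊕_{y ⋗ z, y ≤ x} V_y`. -/
def HasLHomotopyOn (rk : L → ℕ) {V : ℕ → Type*} [∀ i, AddCommGroup (V i)]
    [∀ i, Module R (V i)] (d : ∀ i, V (i + 1) →ₗ[R] V i)
    (Vx : L → ∀ i, Submodule R (V i)) (x : L) : Prop :=
  ∃ (hmem : ∀ (i : ℕ) (v : V (i + 1)), v ∈ Vle Vx x (i + 1) → d i v ∈ Vle Vx x i)
    (h0 : ↥(Submodule.map (d 0) (Vle Vx x 1)) →ₗ[R] V 1)
    (h : ∀ i : ℕ, ↥(Vle Vx x (i + 1)) →ₗ[R] V (i + 2)),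
    (∀ v : ↥(Vle Vx x 1),
      d 1 (h 0 v) + h0 ⟨d 0 v.1, Submodule.mem_map_of_mem v.2⟩ = v.1) ∧
    (∀ (i : ℕ) (v : ↥(Vle Vx x (i + 2))),
      d (i + 2) (h (i + 1) v) + h i ⟨d (i + 1) v.1, hmem (i + 1) v.1 v.2⟩ = v.1) ∧
    (∀ (i : ℕ) (z : L), z ≤ x → rk z = i + 1 →
      ∀ v : ↥(Vle Vx x (i + 1)), v.1 ∈ Vx z (i + 1) →
        h i v ∈ ⨆ y ∈ {y : L | z ⋖ y ∧ y ≤ x}, Vx y (i + 2))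

/-- The complex is `L`-contractible: every subcomplex `V_{≤x}` admits an `L_{≤x}`-homotopy. -/
def LContractible (rk : L → ℕ) {V : ℕ → Type*} [∀ i, AddCommGroup (V i)]
    [∀ i, Module R (V i)] (d : ∀ i, V (i + 1) →ₗ[R] V i)
    (Vx : L → ∀ i, Submodule R (V i)) : Prop :=
  ∀ x : L, HasLHomotopyOn rk d Vx x

end ComplexDefs

theorem IsRankFunction.strictMono {L : Type*} [Lattice L] [Finite L] [OrderBot L] {rk : L → ℕ}
    (hrk : IsRankFunction rk) : StrictMono rk := by
  intro x y hxy
  induction y using WellFoundedLT.induction with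
  | ind y ih =>
    obtain ⟨w, hxw, hwy⟩ := exists_le_covBy_of_lt hxy
    have h1 := hrk.2 w y hwy
    rcases hxw.eq_or_lt with rfl | hlt
    · omega
    · have := ih w hwy.lt hlt
      omega

theorem IsRankFunction.eq_bot_of_eq_zero {L : Type*} [Lattice L] [Finite L] [OrderBot L]
    {rk : L → ℕ} (hrk : IsRankFunction rk) {x : L} (hx : rk x = 0) : x = ⊥ := by
  by_contra h
  have := hrk.strictMono (bot_lt_iff_ne_bot.2 h)
  omega

theorem IsRankFunction.isAtom_of_eq_one {L : Type*} [Lattice L] [Finite L] [OrderBot L]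
    {rk : L → ℕ} (hrk : IsRankFunction rk) {x : L} (hx : rk x = 1) : IsAtom x := by
  refine ⟨?_, fun y hy => hrk.eq_bot_of_eq_zero ?_⟩
  · rintro rfl
    have := hrk.1
    omega
  · have := hrk.strictMono hy
    omega

theorem IsRankFunction.eq_one_of_isAtom {L : Type*} [Lattice L] [OrderBot L]
    {rk : L → ℕ} (hrk : IsRankFunction rk) {x : L} (hx : IsAtom x) : rk x = 1 := by
  rw [hrk.2 ⊥ x hx.bot_covBy, hrk.1]

/-- In a semimodular lattice, the join of two distinct atoms covers each of them. -/
theorem Semimodular.covBy_sup_of_isAtom {L : Type*} [Lattice L] [OrderBot L]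
    (hsemi : Semimodular L) {a b : L} (ha : IsAtom a) (hb : IsAtom b) (hab : a ≠ b) :
    a ⋖ a ⊔ b := by
  rw [sup_comm]
  refine hsemi b a ?_
  rw [(hb.disjoint_of_ne ha hab.symm).eq_bot]
  exact hb.bot_covBy

section MinimalComplex

variable {R : Type*} [Ring R] {L : Type*} [Lattice L] [BoundedOrder L]
  {rk : L → ℕ} {V : ℕ → Type*} [∀ i, AddCommGroup (V i)] [∀ i, Module R (V i)]
  {d : ∀ i, V (i + 1) →ₗ[R] V i} {Vx : L → ∀ i, Submodule R (V i)}

/-- In a minimal complex the differential is injective on every graded piece of positive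
degree. -/
theorem IsMinimal.eq_zero_of_mem [Finite L] [DecidableEq L] (hrk : IsRankFunction rk)
    (hgr : IsCompatGrading rk V d Vx) (hmin : IsMinimal rk d Vx) {x : L} {i : ℕ}
    {v : V (i + 1)} (hv : v ∈ Vx x (i + 1)) (hd : d i v = 0) : v = 0 := by
  by_cases hx : i + 1 = rk x
  · cases i with
    | zero => exact hmin.2.1 x (hrk.isAtom_of_eq_one hx.symm) v hv hd
    | succ i => exact (hmin.2.2 i x hx.symm).1 v hv hd
  · rw [hgr.2.1 x _ hx] at hv
    simpa using hv

/-- If two elements meet trivially, the images of their pieces under a differential of positive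
degree are disjoint. -/
theorem IsCompatGrading.disjoint_map [Finite L] [DecidableEq L] (hrk : IsRankFunction rk)
    (hgr : IsCompatGrading rk V d Vx) {y z : L} (hyz : Disjoint y z) (i : ℕ) :
    Disjoint ((Vx y (i + 2)).map (d (i + 1))) ((Vx z (i + 2)).map (d (i + 1))) := by
  by_cases hy : i + 2 = rk y
  swap
  · simp [hgr.2.1 y _ hy]
  by_cases hz : i + 2 = rk z
  swap
  · simp [hgr.2.1 z _ hz]
  refine Disjoint.mono (hgr.2.2.2 (i + 1) y hy.symm) (hgr.2.2.2 (i + 1) z hz.symm) ?_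
  refine (hgr.2.2.1 (i + 1)).submodule_iSupIndep.disjoint_biSup_biSup' ?_ (Set.toFinite _)
  rw [Set.disjoint_left]
  intro w hwy hwz
  have hw : w = ⊥ := le_bot_iff.1 (hyz (CovBy.le hwy) (CovBy.le hwz))
  have h1 := hrk.2 w y hwy
  have h2 := hrk.1
  rw [hw] at h1
  omega

end MinimalComplex

/-- If `x = y ⊔ z` and the atoms below `x` are partitioned by `y` and `z`, then an indecomposable
element covered by `x` equals `y` or `z`. -/
theorem CovBy.eq_or_eq_of_not_decomposable {L : Type*} [Lattice L] [Finite L] [OrderBot L]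
    (hatom : Atomistic L) {x y z w : L} (hy : y ≠ ⊥) (hz : z ≠ ⊥) (hyz : y ⊔ z = x)
    (hat : ∀ a : L, IsAtom a → a ≤ x → Xor' (a ≤ y) (a ≤ z)) (hw : w ⋖ x)
    (hdec : ¬ Decomposable w) : w = y ∨ w = z := by
  obtain ⟨s, hs, hsw⟩ := hatom w
  have hle : ∀ a ∈ s, a ≤ w := fun a ha => hsw ▸ Finset.le_sup (f := id) ha
  have hsup : w ⊓ y ⊔ w ⊓ z = w := by
    refine le_antisymm (sup_le inf_le_left inf_le_left) ?_
    conv_lhs => rw [← hsw]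
    refine Finset.sup_le fun a ha => ?_
    rcases hat a (hs a ha) ((hle a ha).trans hw.le) with h | h
    · exact le_sup_of_le_left (le_inf (hle a ha) h.1)
    · exact le_sup_of_le_right (le_inf (hle a ha) h.1)
  have hyx : y ≠ x := by
    rintro rfl
    obtain ⟨a, ha, haz⟩ := (eq_bot_or_exists_atom_le z).resolve_left hz
    have hay : a ≤ y := haz.trans (sup_eq_left.1 hyz)
    rcases hat a ha hay with h | h
    · exact h.2 haz
    · exact h.2 hay
  have hzx : z ≠ x := by
    rintro rfl
    obtain ⟨a, ha, hay⟩ := (eq_bot_or_exists_atom_le y).resolve_left hy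
    have haz : a ≤ z := hay.trans (sup_eq_right.1 hyz)
    rcases hat a ha haz with h | h
    · exact h.2 haz
    · exact h.2 hay
  have hylt : y < x := lt_of_le_of_ne (hyz ▸ le_sup_left) hyx
  have hzlt : z < x := lt_of_le_of_ne (hyz ▸ le_sup_right) hzx
  by_cases h1 : w ⊓ y = ⊥
  · rw [h1, bot_sup_eq, inf_eq_left] at hsup
    exact Or.inr (((hw.eq_or_eq hsup hzlt.le).resolve_right hzx).symm)
  by_cases h2 : w ⊓ z = ⊥
  · rw [h2, sup_bot_eq, inf_eq_left] at hsup
    exact Or.inl (((hw.eq_or_eq hsup hylt.le).resolve_right hyx).symm)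
  refine absurd ⟨w ⊓ y, w ⊓ z, h1, h2, hsup, fun a ha haw => ?_⟩ hdec
  simpa [haw] using hat a ha (haw.trans hw.le)

/-- The minimal complex of an atomic datum is supported on indecomposables if and only if the
datum is orthogonal (the atom pieces `U_a = ∂(V_a)` and `U_b = ∂(V_b)` meet trivially whenever
`a ⊔ b` is decomposable). -/
theorem stmt7 {L : Type*} [Lattice L] [Fintype L] [DecidableEq L] [BoundedOrder L]
    (hatom : Atomistic L) (hsemi : Semimodular L)
    (rk : L → ℕ) (hrk : IsRankFunction rk)
    {R : Type*} [Ring R] (V : ℕ → Type*) [∀ i, AddCommGroup (V i)] [∀ i, Module R (V i)]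
    (d : ∀ i, V (i + 1) →ₗ[R] V i) (Vx : L → ∀ i, Submodule R (V i))
    (hgr : IsCompatGrading rk V d Vx)
    (hmin : IsMinimal rk d Vx) :
    (∀ x : L, Decomposable x → ∀ i : ℕ, Vx x i = ⊥) ↔
    (∀ a b : L, IsAtom a → IsAtom b → a ≠ b → Decomposable (a ⊔ b) →
      Submodule.map (d 0) (Vx a 1) ⊓ Submodule.map (d 0) (Vx b 1) = ⊥) := by
  constructor
  · intro hsupp a b ha hb hab hdec
    rw [← disjoint_iff, Submodule.disjoint_def]
    rintro u ⟨p, hp, rfl⟩ ⟨q, hq, hpq⟩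
    have hax := hsemi.covBy_sup_of_isAtom ha hb hab
    have hbx : b ⋖ a ⊔ b := sup_comm b a ▸ hsemi.covBy_sup_of_isAtom hb ha hab.symm
    have hrx : rk (a ⊔ b) = 0 + 2 := by
      rw [hrk.2 _ _ hax, hrk.eq_one_of_isAtom ha]
    have hker := (hmin.2.2 0 _ hrx).2
    rw [hsupp _ hdec, Submodule.map_bot] at hker
    have hmem : p - q ∈ (⊥ : Submodule R (V 1)) := by
      rw [hker]
      refine ⟨sub_mem ?_ ?_, ?_⟩
      · exact (le_biSup (fun y => Vx y 1) (show a ∈ {y : L | y ⋖ a ⊔ b} from hax)) hp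
      · exact (le_biSup (fun y => Vx y 1) (show b ∈ {y : L | y ⋖ a ⊔ b} from hbx)) hq
      · simp [hpq]
    obtain rfl : p = q := sub_eq_zero.1 ((Submodule.mem_bot R).1 hmem)
    have hp0 : p = 0 := Submodule.disjoint_def.1
      ((hgr.2.2.1 1).submodule_iSupIndep.pairwiseDisjoint hab) p hp hq
    rw [hp0, map_zero]
  · intro horth
    have key : ∀ (n : ℕ) (x : L), rk x = n → Decomposable x → Vx x n = ⊥ := by
      intro n
      induction n with
      | zero =>
        rintro x hx ⟨y, z, hy, -, hyz, -⟩
        have hx0 := hrk.eq_bot_of_eq_zero hx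
        exact absurd (le_bot_iff.1 (hx0 ▸ hyz ▸ le_sup_left)) hy
      | succ n ih =>
        rintro x hx ⟨y, z, hy, hz, hyz, hat⟩
        have hdisj : Disjoint y z := by
          rw [disjoint_iff]
          by_contra hne
          obtain ⟨a, ha, hle⟩ := (eq_bot_or_exists_atom_le _).resolve_left hne
          have hay := hle.trans inf_le_left
          have haz := hle.trans inf_le_right
          rcases hat a ha (hay.trans (hyz ▸ le_sup_left)) with h | h
          · exact h.2 haz
          · exact h.2 hay
        cases n with
        | zero =>
          have hxa := hrk.isAtom_of_eq_one hx
          have h1 := (hxa.le_iff.1 (hyz ▸ le_sup_left : y ≤ x)).resolve_left hy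
          have h2 := (hxa.le_iff.1 (hyz ▸ le_sup_right : z ≤ x)).resolve_left hz
          rw [h1, h2, disjoint_self] at hdisj
          exact absurd hdisj hxa.1
        | succ n =>
          have hle : (⨆ w ∈ {w : L | w ⋖ x}, Vx w (n + 1)) ≤ Vx y (n + 1) ⊔ Vx z (n + 1) := by
            refine iSup₂_le fun w hw => ?_
            by_cases hdec : Decomposable w
            · have := hrk.2 w x hw
              rw [ih w (by omega) hdec]
              exact bot_le
            · rcases CovBy.eq_or_eq_of_not_decomposable hatom hy hz hyz hat hw hdec with
                rfl | rfl
              · exact le_sup_left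
              · exact le_sup_right
          have hmap : Disjoint ((Vx y (n + 1)).map (d n)) ((Vx z (n + 1)).map (d n)) := by
            cases n with
            | succ n => exact hgr.disjoint_map hrk hdisj n
            | zero =>
              by_cases hy1 : 1 = rk y
              swap
              · simp [hgr.2.1 y _ hy1]
              by_cases hz1 : 1 = rk z
              swap
              · simp [hgr.2.1 z _ hz1]
              rw [disjoint_iff]
              refine horth y z (hrk.isAtom_of_eq_one hy1.symm) (hrk.isAtom_of_eq_one hz1.symm)
                (fun h => hy (disjoint_self.1 (h ▸ hdisj))) ?_
              exact ⟨y, z, hy, hz, rfl, hyz.symm ▸ hat⟩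
          rw [eq_bot_iff]
          intro v hv
          refine (Submodule.mem_bot R).2 (hmin.eq_zero_of_mem hrk hgr hv ?_)
          have hdv := (hmin.2.2 n x hx).2.le (Submodule.mem_map_of_mem hv)
          obtain ⟨p, hp, q, hq, hpq⟩ := Submodule.mem_sup.1 (hle hdv.1)
          have hsum : d n p + d n q = 0 := by
            rw [← map_add, hpq]
            exact hdv.2
          have hdp : d n p = 0 := by
            refine Submodule.disjoint_def.1 hmap _ (Submodule.mem_map_of_mem hp) ?_
            rw [eq_neg_of_add_eq_zero_left hsum]
            exact neg_mem (Submodule.mem_map_of_mem hq)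
          rw [hdp, zero_add] at hsum
          rw [← hpq, hmin.eq_zero_of_mem hrk hgr hp hdp, hmin.eq_zero_of_mem hrk hgr hq hsum,
            add_zero]
    intro x hdec i
    by_cases hi : i = rk x
    · rw [hi]
      exact key _ x rfl hdec
    · exact hgr.2.1 x i hi
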